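/- Let (Ξ, Ξ^∞) and (Λ, Λ^∞) be countable approximate groups and let f : (Ξ, Ξ^∞) → (Λ, Λ^∞) be a global morphism. Then asdim Ξ ≤ asdim Λ + asdim (Ξ² ∩ ker f), where asymptotic dimensions are computed with respect to restrictions of left-invariant proper metrics on Ξ^∞ and Λ^∞ respectively. -/

import Mathlib

open Set Filter Pointwise

section Defs

variable {X Y G H : Type*}

/-- `d` is a metric on `X`. -/
def IsMetric (d : X → X → ℝ) : Prop :=
  (∀ x y, 0 ≤ d x y) ∧ (∀ x y, d x y = 0 ↔ x = y) ∧ (∀ x y, d x y = d y x) ∧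
    (∀ x y z, d x z ≤ d x y + d y z)

/-- `d` is a left-invariant metric on the group `G`. -/
def IsLeftInvariant [Group G] (d : G → G → ℝ) : Prop :=
  ∀ g x y : G, d (g * x) (g * y) = d x y

/-- `d` is proper: closed balls are compact, where a countable group is regarded as a
discrete topological space. -/
def IsProperMetric (d : G → G → ℝ) : Prop :=
  ∀ (x : G) (r : ℝ), @IsCompact G ⊥ {y | d x y ≤ r}

/-- The (left) defect set `D(f) = {f(y)⁻¹ f(x)⁻¹ f(xy) | x y ∈ G}` of a map between groups. -/
def defectSet [Group G] [Group H] (f : G → H) : Set H :=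
  {h | ∃ x y : G, h = (f y)⁻¹ * (f x)⁻¹ * f (x * y)}

/-- `f` is a quasimorphism if its defect set is finite. -/
def IsQuasimorphism [Group G] [Group H] (f : G → H) : Prop :=
  (defectSet f).Finite

/-- `f` is symmetric: `f(a⁻¹) = f(a)⁻¹`. -/
def IsSymmetricMap [Group G] [Group H] (f : G → H) : Prop :=
  ∀ a : G, f a⁻¹ = (f a)⁻¹

/-- `f` is unital: `f(e) = e`. -/
def IsUnitalMap [Group G] [Group H] (f : G → H) : Prop :=
  f 1 = 1

/-- `Λ` is an approximate subgroup of `G`: symmetric, unital and `Λ² ⊆ ΛF` for a finite `F`. -/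
def IsApproxSubgroup [Group G] (Λ : Set G) : Prop :=
  Λ⁻¹ = Λ ∧ (1 : G) ∈ Λ ∧ ∃ F : Set G, F.Finite ∧ Λ * Λ ⊆ Λ * F

/-- The subset `s` of `X` has asymptotic dimension at most `n`, with respect to the
(restriction of the) metric `d`: for every `R > 0` there is a cover of `s` by subsets of `s`,
uniformly bounded by some `D > 0`, splitting into `n + 1` `R`-disjoint families. -/
def ASDimLE (d : X → X → ℝ) (s : Set X) (n : ℕ) : Prop :=
  ∀ R : ℝ, 0 < R → ∃ D : ℝ, 0 < D ∧ ∃ 𝒰 : Fin (n + 1) → Set (Set X),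
    (∀ i, ∀ u ∈ 𝒰 i, u ⊆ s) ∧
    (s ⊆ ⋃ i, ⋃₀ 𝒰 i) ∧
    (∀ i, ∀ u ∈ 𝒰 i, ∀ x ∈ u, ∀ y ∈ u, d x y ≤ D) ∧
    (∀ i, ∀ u ∈ 𝒰 i, ∀ v ∈ 𝒰 i, u ≠ v → ∀ x ∈ u, ∀ y ∈ v, R ≤ d x y)

/-- The asymptotic dimension of the subset `s` of `X` with respect to the metric `d`,
as an element of `ℕ∞` (`⊤` means infinite asymptotic dimension). -/
noncomputable def asdim (d : X → X → ℝ) (s : Set X) : ℕ∞ :=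
  sInf ((fun n : ℕ => (n : ℕ∞)) '' {n | ASDimLE d s n})

/-- A family `𝒴` of subsets of `X` has asymptotic dimension uniformly bounded by `n`: for
every `R > 0` there is a common `D > 0` such that every member admits a `D`-bounded cover
splitting into `n + 1` `R`-disjoint families. -/
def ASDimUnifLE {ι : Type*} (d : X → X → ℝ) (𝒴 : ι → Set X) (n : ℕ) : Prop :=
  ∀ R : ℝ, 0 < R → ∃ D : ℝ, 0 < D ∧ ∀ α : ι, ∃ 𝒰 : Fin (n + 1) → Set (Set X),
    (∀ i, ∀ u ∈ 𝒰 i, u ⊆ 𝒴 α) ∧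
    (𝒴 α ⊆ ⋃ i, ⋃₀ 𝒰 i) ∧
    (∀ i, ∀ u ∈ 𝒰 i, ∀ x ∈ u, ∀ y ∈ u, d x y ≤ D) ∧
    (∀ i, ∀ u ∈ 𝒰 i, ∀ v ∈ 𝒰 i, u ≠ v → ∀ x ∈ u, ∀ y ∈ v, R ≤ d x y)

/-- `f` is coarsely Lipschitz on the subset `s`. -/
def IsCoarselyLipschitzOn (dX : X → X → ℝ) (dY : Y → Y → ℝ) (s : Set X) (f : X → Y) : Prop :=
  ∃ Φ : ℝ → ℝ, (∀ t, 0 ≤ t → 0 ≤ Φ t) ∧ MonotoneOn Φ (Ici (0 : ℝ)) ∧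
    Tendsto Φ atTop atTop ∧ ∀ x ∈ s, ∀ x' ∈ s, dY (f x) (f x') ≤ Φ (dX x x')

/-- `f` is coarsely Lipschitz: `d_Y(f x, f x') ≤ Φ₊(d_X(x, x'))` for a non-decreasing
`Φ₊ : [0,∞) → [0,∞)` tending to `∞`. -/
def IsCoarselyLipschitz (dX : X → X → ℝ) (dY : Y → Y → ℝ) (f : X → Y) : Prop :=
  ∃ Φ : ℝ → ℝ, (∀ t, 0 ≤ t → 0 ≤ Φ t) ∧ MonotoneOn Φ (Ici (0 : ℝ)) ∧
    Tendsto Φ atTop atTop ∧ ∀ x x' : X, dY (f x) (f x') ≤ Φ (dX x x')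

/-- `f` is a coarse equivalence from `(s, dX)` to `(t, dY)`: a coarse embedding whose image
is coarsely dense in `t`. -/
def IsCoarseEquivOn (dX : X → X → ℝ) (dY : Y → Y → ℝ) (s : Set X) (t : Set Y) (f : X → Y) :
    Prop :=
  MapsTo f s t ∧
  (∃ Φm Φp : ℝ → ℝ, (∀ u, 0 ≤ u → 0 ≤ Φm u) ∧ (∀ u, 0 ≤ u → 0 ≤ Φp u) ∧
    MonotoneOn Φm (Ici (0 : ℝ)) ∧ MonotoneOn Φp (Ici (0 : ℝ)) ∧
    Tendsto Φm atTop atTop ∧ Tendsto Φp atTop atTop ∧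
    ∀ x ∈ s, ∀ x' ∈ s,
      Φm (dX x x') ≤ dY (f x) (f x') ∧ dY (f x) (f x') ≤ Φp (dX x x')) ∧
  ∃ L : ℝ, 0 < L ∧ ∀ y ∈ t, ∃ x ∈ s, dY y (f x) < L

/-- `f : (X, dX) → (Y, dY)` is a coarse equivalence. -/
def IsCoarseEquiv (dX : X → X → ℝ) (dY : Y → Y → ℝ) (f : X → Y) : Prop :=
  IsCoarseEquivOn dX dY univ univ f

end Defs

section Helpers

variable {X Y Z : Type*}

def Ch (d : X → X → ℝ) (S : Set X) (r : ℝ) : X → X → Prop :=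
  Relation.ReflTransGen (fun a b => b ∈ S ∧ d a b ≤ r)

def QQ (d e : X → X → ℝ) (A : Set X) (r R D : ℝ) : Prop :=
  ∀ S, S ⊆ A → (∀ x ∈ S, ∀ y ∈ S, e x y ≤ R) → ∀ x ∈ S, ∀ y, Ch d S r x y → d x y ≤ D

lemma Ch.mem {d : X → X → ℝ} {S : Set X} {r : ℝ} {x y : X} (h : Ch d S r x y) (hx : x ∈ S) :
    y ∈ S := by
  induction h with
  | refl => exact hx
  | tail _ h2 _ => exact h2.1

lemma Ch.symm' {d : X → X → ℝ} (hd : IsMetric d) {S : Set X} {r : ℝ} {x y : X}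
    (h : Ch d S r x y) (hx : x ∈ S) : Ch d S r y x := by
  induction h with
  | refl => exact Relation.ReflTransGen.refl
  | @tail b c h1 h2 ih =>
    have hb : b ∈ S := Ch.mem h1 hx
    refine Relation.ReflTransGen.trans (Relation.ReflTransGen.single ⟨hb, ?_⟩) ih
    rw [hd.2.2.1]; exact h2.2

lemma Ch.self {d : X → X → ℝ} {S : Set X} {r : ℝ} {x y : X} (h : Ch d S r x y) :
    Ch d {z | Ch d S r x z} r x y := by
  induction h with
  | refl => exact Relation.ReflTransGen.refl
  | @tail b c h1 h2 ih =>
    exact Relation.ReflTransGen.tail ih ⟨Relation.ReflTransGen.tail h1 h2, h2.2⟩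

lemma Ch.transport {d : X → X → ℝ} {dZ : Z → Z → ℝ} {S : Set X} {T : Set Z} {r r' : ℝ}
    (ρ : X → Z → Prop) (h1 : ∀ x ∈ S, ∃ z ∈ T, ρ x z)
    (h2 : ∀ x x' z z', ρ x z → ρ x' z' → d x x' ≤ r → dZ z z' ≤ r')
    {x y : X} {z : Z} (hz : z ∈ T) (hxz : ρ x z) (h : Ch d S r x y) :
    ∃ w ∈ T, ρ y w ∧ Ch dZ T r' z w := by
  induction h with
  | refl => exact ⟨z, hz, hxz, Relation.ReflTransGen.refl⟩
  | @tail b c _ hbc ih =>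
    obtain ⟨w, hw, hbw, hch⟩ := ih
    obtain ⟨v, hv, hcv⟩ := h1 c hbc.1
    exact ⟨v, hv, hcv, Relation.ReflTransGen.tail hch ⟨hv, h2 _ _ _ _ hbw hcv hbc.2⟩⟩

lemma QQ.mono {d e : X → X → ℝ} {A : Set X} {r R D D' : ℝ} (h : QQ d e A r R D) (hD : D ≤ D') :
    QQ d e A r R D' := fun S h1 h2 x hx y hy => (h S h1 h2 x hx y hy).trans hD

lemma QQ.union {d e : X → X → ℝ} (hd : IsMetric d) {A A' : Set X} {r R D1 D2 : ℝ}
    (hr : 0 < r) (hD1 : 0 ≤ D1) (hD2 : 0 ≤ D2)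
    (h1 : QQ d e A r R D1) (h2 : QQ d e A' (D1 + 2 * r) R D2) :
    QQ d e (A ∪ A') r R (2 * D1 + 2 * r + D2) := by
  intro S hS hR x hx y hxy
  obtain ⟨hnn, hz, hsy, htr⟩ := hd
  have b1 : ∀ a ∈ S ∩ A, ∀ b, Ch d (S ∩ A) r a b → d a b ≤ D1 :=
    h1 (S ∩ A) inter_subset_right (fun x hx y hy => hR x hx.1 y hy.1)
  have b2 : ∀ a ∈ S ∩ A', ∀ b, Ch d (S ∩ A') (D1 + 2 * r) a b → d a b ≤ D2 :=
    h2 (S ∩ A') inter_subset_right (fun x hx y hy => hR x hx.1 y hy.1)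
  have key : (x ∈ A ∧ Ch d (S ∩ A) r x y) ∨
      ∃ a ∈ S ∩ A', d x a ≤ D1 + r ∧ ∃ b, Ch d (S ∩ A') (D1 + 2 * r) a b ∧
        (y = b ∨ ∃ z ∈ S ∩ A, d b z ≤ r ∧ Ch d (S ∩ A) r z y) := by
    induction hxy with
    | refl =>
      rcases hS hx with h | h
      · exact Or.inl ⟨h, Relation.ReflTransGen.refl⟩
      · refine Or.inr ⟨x, ⟨hx, h⟩, ?_, x, Relation.ReflTransGen.refl, Or.inl rfl⟩
        rw [(hz x x).2 rfl]; linarith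
    | @tail b c _ hbc ih =>
      obtain ⟨hcS, hbc⟩ := hbc
      rcases ih with ⟨hxA, hch⟩ | ⟨a, ha, hxa, b', hab', hlast⟩
      · rcases hS hcS with h | h
        · exact Or.inl ⟨hxA, Relation.ReflTransGen.tail hch ⟨⟨hcS, h⟩, hbc⟩⟩
        · refine Or.inr ⟨c, ⟨hcS, h⟩, ?_, c, Relation.ReflTransGen.refl, Or.inl rfl⟩
          have := b1 x ⟨hx, hxA⟩ b hch
          linarith [htr x b c]
      · rcases hS hcS with h | h
        · refine Or.inr ⟨a, ha, hxa, b', hab', Or.inr ?_⟩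
          rcases hlast with rfl | ⟨z, hzz, hbz, hzb⟩
          · exact ⟨c, ⟨hcS, h⟩, hbc, Relation.ReflTransGen.refl⟩
          · exact ⟨z, hzz, hbz, Relation.ReflTransGen.tail hzb ⟨⟨hcS, h⟩, hbc⟩⟩
        · refine Or.inr ⟨a, ha, hxa, c, ?_, Or.inl rfl⟩
          refine Relation.ReflTransGen.tail hab' ⟨⟨hcS, h⟩, ?_⟩
          rcases hlast with rfl | ⟨z, hzz, hbz, hzb⟩
          · linarith
          · have := b1 z hzz b hzb
            linarith [htr b' z c, htr z b c]
  rcases key with ⟨hxA, hch⟩ | ⟨a, ha, hxa, b, hab, hlast⟩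
  · linarith [b1 x ⟨hx, hxA⟩ y hch]
  · have h3 := b2 a ha b hab
    rcases hlast with rfl | ⟨z, hzz, hbz, hzy⟩
    · linarith [htr x a y]
    · linarith [htr x a y, htr a b y, htr b z y, b1 z hzz y hzy]

/-- decomposition of `s` at all scales `r`, local scale `R` fixed -/
def LQ (d e : X → X → ℝ) (s : Set X) (n : ℕ) (R : ℝ) : Prop :=
  ∀ r, 0 < r → ∃ D, 0 ≤ D ∧ ∃ A : ℕ → Set X, (∀ i, A i ⊆ s) ∧
    (∀ x ∈ s, ∃ i < n + 1, x ∈ A i) ∧ ∀ i < n + 1, QQ d e (A i) r R D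

lemma LQ.union {d e : X → X → ℝ} (hd : IsMetric d) {s t : Set X} {n : ℕ} {R : ℝ}
    (hs : LQ d e s n R) (ht : LQ d e t n R) : LQ d e (s ∪ t) n R := by
  intro r hr
  obtain ⟨D1, hD1, A, hA, hAc, hAQ⟩ := hs r hr
  obtain ⟨D2, hD2, B, hB, hBc, hBQ⟩ := ht (D1 + 2 * r) (by linarith)
  refine ⟨2 * D1 + 2 * r + D2, by linarith, fun i => A i ∪ B i,
    fun i => union_subset_union (hA i) (hB i), ?_, fun i hi =>
      QQ.union hd hr hD1 hD2 (hAQ i hi) (hBQ i hi)⟩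
  rintro x (hx | hx)
  · obtain ⟨i, hi, h⟩ := hAc x hx
    exact ⟨i, hi, Or.inl h⟩
  · obtain ⟨i, hi, h⟩ := hBc x hx
    exact ⟨i, hi, Or.inr h⟩

lemma LQ.iUnion {d e : X → X → ℝ} (hd : IsMetric d) {n : ℕ} {R : ℝ} (M : ℕ) (s : ℕ → Set X)
    (hs : ∀ j < M, LQ d e (s j) n R) : LQ d e (⋃ j < M, s j) n R := by
  induction M with
  | zero =>
    intro r hr
    refine ⟨0, le_rfl, fun _ => ∅, by simp, by simp, ?_⟩
    intro i _ S hS _ x hx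
    exact absurd (hS hx) (by simp)
  | succ M ih =>
    rw [Set.biUnion_lt_succ]
    exact LQ.union hd (ih fun j hj => hs j (by omega)) (hs M (by omega))

open Classical in
/-- Kolmogorov type decompositions -/
def KK (d e : X → X → ℝ) (s : Set X) (n k : ℕ) : Prop :=
  ∀ r R, 0 < r → ∃ D, 0 ≤ D ∧ ∃ A : ℕ → Set X, (∀ i, A i ⊆ s) ∧
    (∀ x ∈ s, k ≤ n + ((Finset.range k).filter (fun i => x ∈ A i)).card) ∧
    ∀ i < k, QQ d e (A i) r R D

lemma KK.base {d e : X → X → ℝ} {s : Set X} {n : ℕ} (h : ∀ R, LQ d e s n R) :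
    KK d e s n (n + 1) := by
  classical
  intro r R hr
  obtain ⟨D, hD, A, hA, hAc, hAQ⟩ := h R r hr
  refine ⟨D, hD, A, hA, ?_, hAQ⟩
  intro x hx
  obtain ⟨i, hi, hxi⟩ := hAc x hx
  have : 0 < ((Finset.range (n + 1)).filter (fun i => x ∈ A i)).card :=
    Finset.card_pos.2 ⟨i, by simp [hi, hxi]⟩
  convert Nat.add_le_add_left this n

lemma KK.step {d e : X → X → ℝ} (hd : IsMetric d) (hes : ∀ x y, e x y = e y x)
    (het : ∀ x y z, e x z ≤ e x y + e y z)
    (hel : ∀ r, ∃ P, 0 ≤ P ∧ ∀ x y, d x y ≤ r → e x y ≤ P)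
    {s : Set X} {n k : ℕ} (hk : n + 1 ≤ k) (h : KK d e s n k) : KK d e s n (k + 1) := by
  classical
  intro r R hr
  obtain ⟨P, hP, hPe⟩ := hel r
  obtain ⟨D, hD, A, hA, hAc, hAQ⟩ := h (3 * r) (R + 2 * P) (by linarith)
  obtain ⟨hnn, hz, hsy, htr⟩ := hd
  set A' : ℕ → Set X := fun i => {x | x ∈ s ∧ ∃ a ∈ A i, d x a ≤ r} with hA'
  set I : X → Finset ℕ := fun x => (Finset.range k).filter (fun i => x ∈ A i) with hI
  set I' : X → Finset ℕ := fun x => (Finset.range k).filter (fun i => x ∈ A' i) with hI'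
  set N : Set X := {x | x ∈ s ∧ I x = I' x ∧ n + (I x).card = k} with hN
  have hsub : ∀ i, A i ⊆ A' i := fun i x hx =>
    ⟨hA i hx, x, hx, by rw [(hz x x).2 rfl]; exact hr.le⟩
  refine ⟨D + 2 * r, by linarith, fun i => if i < k then A' i else N, ?_, ?_, ?_⟩
  · intro i
    dsimp only
    split_ifs
    · exact fun x hx => hx.1
    · exact fun x hx => hx.1
  · intro x hx
    have h1 : k ≤ n + (I x).card := by
      have := hAc x hx
      convert this
    have h2 : I x ⊆ I' x := by
      intro i hi
      simp only [hI, hI', Finset.mem_filter] at hi ⊢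
      exact ⟨hi.1, hsub i hi.2⟩
    have h3 := Finset.card_le_card h2
    by_cases h4 : k + 1 ≤ n + (I' x).card
    · refine h4.trans (Nat.add_le_add_left (Finset.card_le_card ?_) n)
      intro i hi
      simp only [hI', Finset.mem_filter, Finset.mem_range] at hi ⊢
      exact ⟨by omega, by rw [if_pos hi.1]; exact hi.2⟩
    · have h5 : I x = I' x := Finset.eq_of_subset_of_card_le h2 (by omega)
      have hxN : x ∈ N := ⟨hx, h5, by omega⟩
      have h6 : insert k (I' x) ⊆
          (Finset.range (k + 1)).filter (fun i => x ∈ if i < k then A' i else N) := by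
        intro i hi
        rw [Finset.mem_insert] at hi
        simp only [hI', Finset.mem_filter, Finset.mem_range] at hi ⊢
        rcases hi with rfl | hi
        · exact ⟨by omega, by rw [if_neg (lt_irrefl _)]; exact hxN⟩
        · exact ⟨by omega, by rw [if_pos hi.1]; exact hi.2⟩
      have h7 := Finset.card_le_card h6
      rw [Finset.card_insert_of_notMem (by simp [hI'])] at h7
      have h8 : k + 1 ≤ n + ((Finset.range (k + 1)).filter
        (fun i => x ∈ if i < k then A' i else N)).card := by omega
      convert h8
  · intro i hi
    dsimp only
    split_ifs with hik
    · intro S hS hR x hx y hxy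
      set T : Set X := {a | a ∈ A i ∧ ∃ x ∈ S, d x a ≤ r} with hT
      have hST : ∀ x ∈ S, ∃ z ∈ T, d x z ≤ r := by
        intro x hx
        obtain ⟨_, a, ha, hxa⟩ := hS hx
        exact ⟨a, ⟨ha, x, hx, hxa⟩, hxa⟩
      obtain ⟨z, hzT, hxz⟩ := hST x hx
      obtain ⟨w, hwT, hyw, hch⟩ := Ch.transport (dZ := d) (r' := 3 * r)
        (fun x z => d x z ≤ r) hST (by
          intro x x' z z' h1 h2 h3
          linarith [htr z x z', htr x x' z', hsy z x]) hzT hxz hxy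
      have := hAQ i hik T (fun a ha => ha.1) (by
        rintro a ⟨_, u, hu, hua⟩ b ⟨_, v, hv, hvb⟩
        linarith [het a u b, het u v b, hes a u, hPe u a hua, hPe v b hvb, hR u hu v hv])
        z hzT w hch
      linarith [htr x z y, htr z w y, hsy y w]
    · intro S hS hR x hx y hxy
      have hstep : ∀ a ∈ N, ∀ b ∈ N, d a b ≤ r → I a = I b := by
        intro a ha b hb hab
        refine Finset.eq_of_subset_of_card_le ?_ (by have := ha.2.2; have := hb.2.2; omega)
        intro j hj
        rw [hb.2.1]
        simp only [hI, hI', Finset.mem_filter] at hj ⊢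
        exact ⟨hj.1, hb.1, a, hj.2, by rw [hsy]; exact hab⟩
      have hxN := hS hx
      have hne : (I x).Nonempty := Finset.card_pos.1 (by have := hxN.2.2; omega)
      obtain ⟨j, hj⟩ := hne
      have hj' : j < k ∧ x ∈ A j := by simpa [hI] using hj
      have hch : I y = I x ∧ Ch d (S ∩ A j) (3 * r) x y := by
        induction hxy with
        | refl => exact ⟨rfl, Relation.ReflTransGen.refl⟩
        | @tail b c hb hbc ih =>
          have hbS : b ∈ S := Ch.mem hb hx
          have h1 : I c = I x := by
            rw [← ih.1]; exact (hstep b (hS hbS) c (hS hbc.1) hbc.2).symm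
          have h2 : j ∈ I c := h1 ▸ hj
          have h3 : j < k ∧ c ∈ A j := by simpa [hI] using h2
          exact ⟨h1, Relation.ReflTransGen.tail ih.2 ⟨⟨hbc.1, h3.2⟩, by linarith [hbc.2]⟩⟩
      have := hAQ j hj'.1 (S ∩ A j) inter_subset_right
        (fun u hu v hv => by linarith [hR u hu.1 v hv.1]) x ⟨hx, hj'.2⟩ y hch.2
      linarith

lemma KK.all {d e : X → X → ℝ} (hd : IsMetric d) (hes : ∀ x y, e x y = e y x)
    (het : ∀ x y z, e x z ≤ e x y + e y z)
    (hel : ∀ r, ∃ P, 0 ≤ P ∧ ∀ x y, d x y ≤ r → e x y ≤ P)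
    {s : Set X} {n : ℕ} (h : ∀ R, LQ d e s n R) (m : ℕ) : KK d e s n (n + 1 + m) := by
  induction m with
  | zero => exact KK.base h
  | succ m ih => exact KK.step hd hes het hel (Nat.le_add_right _ _) ih

lemma ASDimLE.dec {d : X → X → ℝ} {s : Set X} {n : ℕ} (h : ASDimLE d s n) (r : ℝ) (hr : 0 < r) :
    ∃ D, 0 ≤ D ∧ ∃ A : ℕ → Set X, (∀ i, A i ⊆ s) ∧
    (∀ x ∈ s, ∃ i < n + 1, x ∈ A i) ∧
    ∀ i < n + 1, ∀ x ∈ A i, ∀ y, Ch d (A i) r x y → d x y ≤ D := by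
  obtain ⟨D, hD, 𝒰, h1, h2, h3, h4⟩ := h (r + 1) (by linarith)
  refine ⟨D, hD.le, fun i => if hi : i < n + 1 then ⋃₀ 𝒰 ⟨i, hi⟩ else ∅, ?_, ?_, ?_⟩
  · intro i
    dsimp only
    split_ifs with hi
    · exact sUnion_subset (h1 _)
    · exact empty_subset _
  · intro x hx
    obtain ⟨i, hi⟩ := mem_iUnion.1 (h2 hx)
    exact ⟨i, i.2, by dsimp only; rw [dif_pos i.2]; exact hi⟩
  · intro i hi x hx y hxy
    simp only [hi, dif_pos] at hx hxy
    obtain ⟨u, hu, hxu⟩ := hx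
    have : y ∈ u := by
      induction hxy with
      | refl => exact hxu
      | @tail b c _ hbc ih =>
        obtain ⟨⟨v, hv, hcv⟩, hbc⟩ := hbc
        by_contra hcu
        have := h4 _ u hu v hv (by rintro rfl; exact hcu hcv) b ih c hcv
        linarith
    exact h3 _ u hu x hxu y this

lemma ASDimLE.of_dec {d : X → X → ℝ} (hd : IsMetric d) {s : Set X} {n : ℕ}
    (h : ∀ r, 0 < r → ∃ D, 0 ≤ D ∧ ∃ A : ℕ → Set X, (∀ i, A i ⊆ s) ∧
    (∀ x ∈ s, ∃ i < n + 1, x ∈ A i) ∧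
    ∀ i < n + 1, ∀ x ∈ A i, ∀ y, Ch d (A i) r x y → d x y ≤ D) : ASDimLE d s n := by
  intro R hR
  obtain ⟨D, hD, A, hA, hc, hb⟩ := h R hR
  refine ⟨2 * D + 1, by linarith, fun i => {u | ∃ x ∈ A i, u = {y | Ch d (A i) R x y}},
    ?_, ?_, ?_, ?_⟩
  · rintro i u ⟨x, hx, rfl⟩ y hy
    exact hA i (Ch.mem hy hx)
  · intro x hx
    obtain ⟨i, hi, hxi⟩ := hc x hx
    exact mem_iUnion.2 ⟨⟨i, hi⟩, _, ⟨x, hxi, rfl⟩, Relation.ReflTransGen.refl⟩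
  · rintro i u ⟨x, hx, rfl⟩ y hy z hz
    have h1 := hb i i.2 x hx y hy
    have h2 := hb i i.2 x hx z hz
    linarith [hd.2.2.2 y x z, hd.2.2.1 y x]
  · rintro i u ⟨x, hx, rfl⟩ v ⟨x', hx', rfl⟩ huv y hy z hz
    by_contra hlt
    apply huv
    have hyA : y ∈ A i := Ch.mem hy hx
    have hzA : z ∈ A i := Ch.mem hz hx'
    have hyz : Ch d (A i) R y z := Relation.ReflTransGen.single ⟨hzA, by linarith⟩
    have hxx' : Ch d (A i) R x x' :=
      (Relation.ReflTransGen.trans hy hyz).trans (Ch.symm' hd hz hx')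
    ext w
    exact ⟨fun hw => Relation.ReflTransGen.trans (Ch.symm' hd hxx' hx) hw,
      fun hw => Relation.ReflTransGen.trans hxx' hw⟩

lemma asdim_cases (d : X → X → ℝ) (s : Set X) :
    asdim d s = ⊤ ∨ ∃ n : ℕ, asdim d s = n ∧ ASDimLE d s n := by
  by_cases h : ∃ n, ASDimLE d s n
  · right
    obtain ⟨n, hn⟩ := h
    have := csInf_mem (s := (fun n : ℕ => (n : ℕ∞)) '' {n | ASDimLE d s n})
      ⟨_, n, hn, rfl⟩
    obtain ⟨m, hm, hm'⟩ := this
    exact ⟨m, hm'.symm, hm⟩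
  · left
    have : {n | ASDimLE d s n} = ∅ := by
      ext n; simpa using fun hn => h ⟨n, hn⟩
    simp [asdim, this]

lemma asdim_le {d : X → X → ℝ} {s : Set X} {n : ℕ} (h : ASDimLE d s n) : asdim d s ≤ n :=
  sInf_le ⟨n, h, rfl⟩

lemma IsProperMetric.finite {d : X → X → ℝ} (h : IsProperMetric d) (x : X) (r : ℝ) :
    {y | d x y ≤ r}.Finite := by
  letI : TopologicalSpace X := ⊥
  haveI : DiscreteTopology X := ⟨rfl⟩
  exact (h x r).finite_of_discrete

lemma finite_bdd (S : Set X) (hS : S.Finite) (φ : X → ℝ) : ∃ P, 0 ≤ P ∧ ∀ x ∈ S, φ x ≤ P := by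
  obtain ⟨P, hP⟩ := (hS.image φ).bddAbove
  exact ⟨max P 0, le_max_right _ _, fun x hx => (hP ⟨x, hx, rfl⟩).trans (le_max_left _ _)⟩

variable {G H : Type*} [Group G] [Group H]

lemma IsLeftInvariant.eq_one {d : G → G → ℝ} (h : IsLeftInvariant d) (x y : G) :
    d x y = d 1 (x⁻¹ * y) := by
  have := h x⁻¹ x y
  rw [inv_mul_cancel] at this
  exact this.symm

lemma hom_coarse (f : G →* H) {d : G → G → ℝ} {d' : H → H → ℝ} (hdli : IsLeftInvariant d)
    (hdp : IsProperMetric d) (hd'li : IsLeftInvariant d') (r : ℝ) :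
    ∃ P, 0 ≤ P ∧ ∀ x y, d x y ≤ r → d' (f x) (f y) ≤ P := by
  obtain ⟨P, hP, h⟩ := finite_bdd _ (hdp.finite 1 r) (fun g => d' 1 (f g))
  refine ⟨P, hP, fun x y hxy => ?_⟩
  rw [hd'li.eq_one, ← map_inv, ← map_mul]
  apply h
  rw [hdli.eq_one] at hxy
  exact hxy

/-- uniform closeness of fibres over bounded sets to translates of the coarse kernel -/
lemma fiber_close (Ξ : Set G) (hΞ : IsApproxSubgroup Ξ) (f : G →* H)
    {d : G → G → ℝ} (hd : IsMetric d) (hdli : IsLeftInvariant d)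
    {d' : H → H → ℝ} (hd'li : IsLeftInvariant d') (hd'p : IsProperMetric d') (R : ℝ) :
    ∃ L, 0 ≤ L ∧ ∀ x₀ ∈ Ξ, ∀ x ∈ Ξ, d' (f x₀) (f x) ≤ R →
      ∃ k ∈ Ξ ^ 2 ∩ (⇑f) ⁻¹' {1}, d x (x₀ * k) ≤ L := by
  classical
  obtain ⟨hinv, h1, F, hF, hFF⟩ := hΞ
  have hinv' : ∀ a ∈ Ξ, a⁻¹ ∈ Ξ := fun a ha => by
    rw [← hinv]; simpa using ha
  let C : G × H → Set G := fun q => {p | (∃ ξ ∈ Ξ, p = ξ * q.1) ∧ f p = q.2}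
  let c : G × H → G := fun q => if h : (C q).Nonempty then h.choose else 1
  have hc : ∀ q, (C q).Nonempty → c q ∈ C q := fun q h => by
    simp only [c, dif_pos h]; exact h.choose_spec
  obtain ⟨L, hL, hLb⟩ := finite_bdd (F ×ˢ {h : H | d' 1 h ≤ R}) (hF.prod (hd'p.finite 1 R))
    (fun q => d 1 (c q)⁻¹)
  refine ⟨L, hL, fun x₀ hx₀ x hx hxR => ?_⟩
  have hmem : x₀⁻¹ * x ∈ Ξ * F := hFF (mul_mem_mul (hinv' _ hx₀) hx)
  obtain ⟨ξ, hξ, φ, hφ, hξφ⟩ := hmem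
  simp only at hξφ
  set q : G × H := (φ, f (x₀⁻¹ * x)) with hq
  have hqC : (C q).Nonempty := ⟨x₀⁻¹ * x, ⟨ξ, hξ, hξφ.symm⟩, rfl⟩
  obtain ⟨⟨ξ', hξ', hcq⟩, hfc⟩ := hc q hqC
  refine ⟨x₀⁻¹ * x * (c q)⁻¹, ⟨?_, ?_⟩, ?_⟩
  · rw [pow_two, hcq, ← hξφ]
    have : ξ * φ * (ξ' * q.1)⁻¹ = ξ * ξ'⁻¹ := by simp [hq, mul_assoc]
    rw [this]
    exact mul_mem_mul hξ (hinv' _ hξ')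
  · rw [mem_preimage, map_mul, map_inv f (c q), hfc]
    simp [hq]
  · rw [hdli.eq_one]
    have : x⁻¹ * (x₀ * (x₀⁻¹ * x * (c q)⁻¹)) = (c q)⁻¹ := by group
    rw [this]
    refine hLb q ⟨hφ, ?_⟩
    rw [hd'li.eq_one, ← map_inv, ← map_mul] at hxR
    exact hxR

lemma fiber_dec (Ξ : Set G) (hΞ : IsApproxSubgroup Ξ) (f : G →* H)
    {d : G → G → ℝ} (hd : IsMetric d) (hdli : IsLeftInvariant d)
    {d' : H → H → ℝ} (hd'li : IsLeftInvariant d') (hd'p : IsProperMetric d')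
    {n : ℕ} (hn : ASDimLE d (Ξ ^ 2 ∩ (⇑f) ⁻¹' {1}) n) (R r : ℝ) (hr : 0 < r) :
    ∃ D, 0 ≤ D ∧ ∀ V : Set H, (∀ a ∈ V, ∀ b ∈ V, d' a b ≤ R) →
      ∃ A : ℕ → Set G, (∀ i, A i ⊆ Ξ ∩ f ⁻¹' V) ∧
      (∀ x ∈ Ξ ∩ f ⁻¹' V, ∃ i < n + 1, x ∈ A i) ∧
      ∀ i < n + 1, ∀ x ∈ A i, ∀ y, Ch d (A i) r x y → d x y ≤ D := by
  obtain ⟨L, hL, hLc⟩ := fiber_close Ξ hΞ f hd hdli hd'li hd'p R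
  obtain ⟨D, hD, B, hB, hBc, hBb⟩ := hn.dec (r + 2 * L) (by linarith)
  obtain ⟨hnn, hz, hsy, htr⟩ := hd
  refine ⟨D + 2 * L, by linarith, fun V hV => ?_⟩
  by_cases hne : (Ξ ∩ f ⁻¹' V).Nonempty
  · obtain ⟨x₀, hx₀, hx₀V⟩ := hne
    refine ⟨fun i => {x | x ∈ Ξ ∩ f ⁻¹' V ∧ ∃ k ∈ B i, d x (x₀ * k) ≤ L},
      fun i x hx => hx.1, ?_, ?_⟩
    · intro x hx
      obtain ⟨k, hk, hxk⟩ := hLc x₀ hx₀ x hx.1 (hV _ hx₀V _ hx.2)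
      obtain ⟨i, hi, hki⟩ := hBc k hk
      exact ⟨i, hi, hx, k, hki, hxk⟩
    · intro i hi x hx y hxy
      obtain ⟨_, z, hz1, hxz⟩ := hx
      obtain ⟨w, hw, hyw, hch⟩ := Ch.transport (dZ := d) (T := B i) (r' := r + 2 * L)
        (fun x k => d x (x₀ * k) ≤ L) (fun x hx => hx.2) (by
          intro x x' k k' h1 h2 h3
          rw [← hdli x₀ k k']
          linarith [htr (x₀ * k) x (x₀ * k'), htr x x' (x₀ * k'), hsy (x₀ * k) x]) hz1 hxz hxy
      have := hBb i hi z hz1 w hch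
      rw [← hdli x₀ z w] at this
      linarith [htr x (x₀ * z) y, htr (x₀ * z) (x₀ * w) y, hsy y (x₀ * w)]
  · refine ⟨fun _ => ∅, by simp, fun x hx => absurd ⟨x, hx⟩ hne, ?_⟩
    intro i _ x hx
    exact absurd hx (by simp)

lemma LQ_of_fibers (Ξ : Set G) (Λ : Set H) (hΞ : IsApproxSubgroup Ξ) (f : G →* H)
    (hf : ∀ x ∈ Ξ, f x ∈ Λ)
    {d : G → G → ℝ} (hd : IsMetric d) (hdli : IsLeftInvariant d)
    {d' : H → H → ℝ} (hd' : IsMetric d') (hd'li : IsLeftInvariant d') (hd'p : IsProperMetric d')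
    {n m : ℕ} (hn : ASDimLE d (Ξ ^ 2 ∩ (⇑f) ⁻¹' {1}) n) (hm : ASDimLE d' Λ m) (R : ℝ) :
    LQ d (fun x y => d' (f x) (f y)) Ξ n R := by
  obtain ⟨DV, hDV, 𝒱, h1, h2, h3, h4⟩ := hm (|R| + 1) (by positivity)
  have hRR := le_abs_self R
  have hpos := abs_nonneg R
  let s : ℕ → Set G := fun j => {x | x ∈ Ξ ∧ ∃ hj : j < m + 1, f x ∈ ⋃₀ 𝒱 ⟨j, hj⟩}
  have hs : Ξ = ⋃ j < m + 1, s j := by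
    ext x
    simp only [mem_iUnion, s, mem_setOf_eq]
    constructor
    · intro hx
      obtain ⟨i, hi⟩ := mem_iUnion.1 (h2 (hf x hx))
      exact ⟨i, i.2, hx, i.2, hi⟩
    · rintro ⟨_, _, hx, _⟩
      exact hx
  rw [hs]
  refine LQ.iUnion hd _ _ fun j hj r hr => ?_
  obtain ⟨D, hD, hfib⟩ := fiber_dec Ξ hΞ f hd hdli hd'li hd'p hn DV r hr
  have hex : ∀ V : 𝒱 ⟨j, hj⟩, _ := fun V => hfib V.1 (h3 _ V.1 V.2)
  choose A hA hAc hAb using hex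
  refine ⟨D, hD, fun i => ⋃ V, A V i, ?_, ?_, ?_⟩
  · intro i x hx
    obtain ⟨V, hV⟩ := mem_iUnion.1 hx
    exact ⟨(hA V i hV).1, hj, V.1, V.2, (hA V i hV).2⟩
  · rintro x ⟨hx, _, V, hV, hxV⟩
    obtain ⟨i, hi, h⟩ := hAc ⟨V, hV⟩ x ⟨hx, hxV⟩
    exact ⟨i, hi, mem_iUnion.2 ⟨_, h⟩⟩
  · intro i hi S hS hR x hx y hxy
    obtain ⟨V, hV⟩ := mem_iUnion.1 (hS hx)
    have hSV : ∀ z ∈ S, z ∈ A V i := by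
      intro z hz
      obtain ⟨W, hW⟩ := mem_iUnion.1 (hS hz)
      by_cases hVW : V = W
      · rw [hVW]; exact hW
      · have := h4 _ V.1 V.2 W.1 W.2 (fun h => hVW (Subtype.ext h)) (f x) (hA V i hV).2
          (f z) (hA W i hW).2
        have h5 := hR x hx z hz
        simp only at h5
        linarith
    obtain ⟨w, hw, rfl, hch⟩ := Ch.transport (dZ := d) (T := A V i) (r' := r)
      (fun x y => x = y) (fun x hx => ⟨x, hSV x hx, rfl⟩)
      (by rintro x x' _ _ rfl rfl h; exact h) hV rfl hxy
    exact hAb V i hi x hV _ hch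

lemma LQ_of_asdim {d : X → X → ℝ} {s : Set X} {n : ℕ} (h : ASDimLE d s n) (R : ℝ) :
    LQ d (fun _ _ => 0) s n R := by
  intro r hr
  obtain ⟨D, hD, A, hA, hAc, hAb⟩ := h.dec r hr
  refine ⟨D, hD, A, hA, hAc, fun i hi S hS _ x hx y hxy => ?_⟩
  obtain ⟨w, hw, rfl, hch⟩ := Ch.transport (dZ := d) (T := A i) (r' := r)
    (fun x y => x = y) (fun x hx => ⟨x, hS hx, rfl⟩)
    (by rintro x x' _ _ rfl rfl h; exact h) (hS hx) rfl hxy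
  exact hAb i hi x (hS hx) _ hch

lemma hurewicz_main (Ξ : Set G) (Λ : Set H) (hΞ : IsApproxSubgroup Ξ) (f : G →* H)
    (hf : ∀ x ∈ Ξ, f x ∈ Λ)
    {d : G → G → ℝ} (hd : IsMetric d) (hdli : IsLeftInvariant d) (hdp : IsProperMetric d)
    {d' : H → H → ℝ} (hd' : IsMetric d') (hd'li : IsLeftInvariant d') (hd'p : IsProperMetric d')
    {n m : ℕ} (hn : ASDimLE d (Ξ ^ 2 ∩ (⇑f) ⁻¹' {1}) n) (hm : ASDimLE d' Λ m) :
    ASDimLE d Ξ (m + n) := by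
  classical
  have hK1 : KK d (fun x y => d' (f x) (f y)) Ξ n (n + 1 + m) :=
    KK.all (e := fun x y => d' (f x) (f y)) hd (fun x y => hd'.2.2.1 _ _)
      (fun x y z => hd'.2.2.2 _ _ _)
      (hom_coarse f hdli hdp hd'li)
      (LQ_of_fibers Ξ Λ hΞ f hf hd hdli hd' hd'li hd'p hn hm) m
  have hK2 : KK d' (fun _ _ => 0) Λ m (m + 1 + n) :=
    KK.all hd' (fun _ _ => rfl) (fun _ _ _ => by simp)
      (fun _ => ⟨0, le_rfl, fun _ _ _ => le_rfl⟩) (LQ_of_asdim hm) n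
  refine ASDimLE.of_dec hd fun r hr => ?_
  obtain ⟨P, hP, hPf⟩ := hom_coarse f hdli hdp hd'li r
  obtain ⟨D', hD', B, hB, hBc, hBQ⟩ := hK2 (P + 1) 0 (by linarith)
  obtain ⟨D, hD, A, hA, hAc, hAQ⟩ := hK1 r (2 * D') hr
  have hk : m + 1 + n = n + 1 + m := by omega
  rw [hk] at hBc hBQ
  refine ⟨D, hD, fun i => A i ∩ f ⁻¹' (B i), fun i x hx => hA i hx.1, ?_, ?_⟩
  · intro x hx
    have c1 := hAc x hx
    have c2 := hBc (f x) (hf x hx)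
    set I := (Finset.range (n + 1 + m)).filter (fun i => x ∈ A i)
    set J := (Finset.range (n + 1 + m)).filter (fun i => f x ∈ B i)
    have hU : (I ∪ J).card ≤ n + 1 + m := by
      have : I ∪ J ⊆ Finset.range (n + 1 + m) :=
        Finset.union_subset (Finset.filter_subset _ _) (Finset.filter_subset _ _)
      simpa using Finset.card_le_card this
    have hUI := Finset.card_union_add_card_inter I J
    have hne : (I ∩ J).Nonempty := Finset.card_pos.1 (by omega)
    obtain ⟨i, hi⟩ := hne
    simp only [I, J, Finset.mem_inter, Finset.mem_filter, Finset.mem_range] at hi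
    exact ⟨i, by omega, hi.1.2, hi.2.2⟩
  · intro i hi x hx y hxy
    have hi' : i < n + 1 + m := by omega
    have hbd : ∀ z, Ch d (A i ∩ f ⁻¹' (B i)) r x z → d' (f x) (f z) ≤ D' := by
      intro z hz
      obtain ⟨w, hw, rfl, hch⟩ := Ch.transport (dZ := d') (T := B i) (r' := P + 1)
        (fun x w => f x = w) (fun x hx => ⟨f x, hx.2, rfl⟩)
        (by rintro x x' _ _ rfl rfl h; linarith [hPf _ _ h]) hx.2 rfl hz
      exact hBQ i hi' (B i) subset_rfl (by simp) (f x) hx.2 _ hch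
    refine hAQ i hi' {z | Ch d (A i ∩ f ⁻¹' (B i)) r x z} (fun z hz => (Ch.mem hz hx).1) ?_
      x Relation.ReflTransGen.refl y (Ch.self hxy)
    intro a ha b hb
    have := hbd a ha
    have := hbd b hb
    linarith [hd'.2.2.2 (f a) (f x) (f b), hd'.2.2.1 (f a) (f x)]

end Helpers

/-- Hurewicz-type formula for global morphisms of countable approximate groups:
`asdim Ξ ≤ asdim Λ + asdim (Ξ² ∩ ker f)`. The approximate groups `(Ξ, Ξ^∞)`, `(Λ, Λ^∞)` are
modelled by countable groups `G = Ξ^∞`, `H = Λ^∞` generated by `Ξ`, `Λ`, and a global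
morphism is a homomorphism `f : G →* H` with `f(Ξ^k) ⊆ Λ^k` for all `k ≥ 1`. -/
theorem hurewicz_of_global_morphism
    {G H : Type*} [Group G] [Group H] [Countable G] [Countable H]
    (Ξ : Set G) (Λ : Set H)
    (hΞ : IsApproxSubgroup Ξ) (hΛ : IsApproxSubgroup Λ)
    (hΞgen : Subgroup.closure Ξ = ⊤) (hΛgen : Subgroup.closure Λ = ⊤)
    (f : G →* H) (hglobal : ∀ k : ℕ, 1 ≤ k → (⇑f) '' (Ξ ^ k) ⊆ Λ ^ k)
    (d : G → G → ℝ) (hd : IsMetric d) (hdli : IsLeftInvariant d) (hdp : IsProperMetric d)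
    (d' : H → H → ℝ) (hd' : IsMetric d') (hd'li : IsLeftInvariant d')
    (hd'p : IsProperMetric d') :
    asdim d Ξ ≤ asdim d' Λ + asdim d (Ξ ^ 2 ∩ (⇑f) ⁻¹' {1}) := by
  have hf : ∀ x ∈ Ξ, f x ∈ Λ := by
    intro x hx
    have := hglobal 1 le_rfl
    rw [pow_one, pow_one] at this
    exact this ⟨x, hx, rfl⟩
  rcases asdim_cases d' Λ with h | ⟨m, h, hm⟩
  · rw [h]; simp
  rcases asdim_cases d (Ξ ^ 2 ∩ (⇑f) ⁻¹' {1}) with h' | ⟨n, h', hn⟩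
  · rw [h']; simp
  rw [h, h']
  have := asdim_le (hurewicz_main Ξ Λ hΞ f hf hd hdli hdp hd' hd'li hd'p hn hm)
  simpa using this
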